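/- (Uniqueness with a reference potential.) If (u₁,v₁) and (u₂,v₂) are two classical solutions of system (P) that additionally satisfy v₁(0) = 0 and v₂(0) = 0, then u₁ = u₂ on [0,L] and v₁ = v₂ on [0,L₁] ∪ [L₁+δ, L]. -/

import Mathlib

open Set MeasureTheory intervalIntegral

/-- The Butler–Volmer nonlinearity `E(x,w) = exp(a(w − f x)) − exp(−b(w − f x))`. -/
noncomputable def E (a b : ℝ) (f : ℝ → ℝ) (x w : ℝ) : ℝ :=
  Real.exp (a * (w - f x)) - Real.exp (-b * (w - f x))

/-- The flux term `−(r u′) + ν·(r (ln c)′)` appearing in the electrolyte equation. -/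
noncomputable def flux (r c : ℝ → ℝ) (ν : ℝ) (u : ℝ → ℝ) : ℝ → ℝ :=
  fun y => -(r y * deriv u y) + ν * (r y * deriv c y / c y)

/-- A classical solution `(u, v)` of the system. -/
def IsSolution (L₁ δ L a b ν dm dp km kp qm qp : ℝ)
    (f r c bm bp u v : ℝ → ℝ) : Prop :=
  -- `u` is continuously differentiable on `[0, L]`
  ContDiffOn ℝ 1 u (Icc 0 L) ∧
  -- `r·u′` is differentiable on `(0, L)`
  DifferentiableOn ℝ (fun y => r y * deriv u y) (Ioo 0 L) ∧
  -- `v` is twice differentiable on `[0, L₁]` and on `[L₁+δ, L]`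
  (∀ x ∈ Icc 0 L₁ ∪ Icc (L₁ + δ) L,
      DifferentiableAt ℝ v x ∧ DifferentiableAt ℝ (deriv v) x) ∧
  -- electrolyte-potential equation on the negative electrode
  (∀ x ∈ Ioo 0 L₁, deriv (flux r c ν u) x = km * bm x * E a b f x (v x - u x)) ∧
  -- electrolyte-potential equation on the separator
  (∀ x ∈ Ioo L₁ (L₁ + δ), deriv (flux r c ν u) x = 0) ∧
  -- electrolyte-potential equation on the positive electrode
  (∀ x ∈ Ioo (L₁ + δ) L, deriv (flux r c ν u) x = kp * bp x * E a b f x (v x - u x)) ∧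
  -- boundary conditions for `u`
  deriv u 0 = 0 ∧ deriv u L = 0 ∧
  -- solid-potential equation on the negative electrode (`−v″ = −(⋯)`)
  (∀ x ∈ Ioo 0 L₁, deriv (deriv v) x = qm * bm x * E a b f x (v x - u x)) ∧
  -- solid-potential equation on the positive electrode (`−v″ = −(⋯)`)
  (∀ x ∈ Ioo (L₁ + δ) L, deriv (deriv v) x = qp * bp x * E a b f x (v x - u x)) ∧
  -- boundary conditions for `v`: `−v′(0) = d₋`, `v′(L) = −d₊`, `v′(L₁) = v′(L₁+δ) = 0`
  deriv v 0 = -dm ∧ deriv v L = -dp ∧ deriv v L₁ = 0 ∧ deriv v (L₁ + δ) = 0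

lemma E_strictMono {a b : ℝ} (ha : 0 < a) (hb : 0 < b) (f : ℝ → ℝ) (x : ℝ) :
    StrictMono (E a b f x) := by
  intro w z h
  have h₁ : Real.exp (a * (w - f x)) < Real.exp (a * (z - f x)) :=
    Real.exp_lt_exp.2 (by nlinarith)
  have h₂ : Real.exp (-b * (z - f x)) < Real.exp (-b * (w - f x)) :=
    Real.exp_lt_exp.2 (by nlinarith)
  unfold E
  linarith

lemma eq_of_hasDerivAt_zero {F : ℝ → ℝ} {p q : ℝ} (hpq : p ≤ q)
    (hF : ContinuousOn F (Icc p q)) (hF' : ∀ x ∈ Ioo p q, HasDerivAt F 0 x) : F q = F p := by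
  rcases hpq.eq_or_lt with rfl | h
  · rfl
  · obtain ⟨y, hy, hy'⟩ := exists_hasDerivAt_eq_slope F (fun _ => 0) h hF hF'
    have : q - p ≠ 0 := (sub_pos.2 h).ne'
    rw [eq_div_iff this, zero_mul] at hy'
    linarith

lemma eq_zero_on_Icc_of_Ioo {F : ℝ → ℝ} {p q : ℝ} (hpq : p < q) (hF : ContinuousOn F (Icc p q))
    (h : ∀ x ∈ Ioo p q, F x = 0) : ∀ x ∈ Icc p q, F x = 0 := by
  have hcl : Icc p q ⊆ closure (Ioo p q) := (closure_Ioo hpq.ne).ge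
  exact Set.EqOn.of_subset_closure (g := fun _ => (0 : ℝ)) h hF continuousOn_const
    Ioo_subset_Icc_self hcl

/-- A function vanishing at both ends of an interval cannot be driven by a quantity `w` of the
same sign as its derivative when `w` vanishes at the right end and decreases wherever `g ≤ 0`. -/
lemma false_of_sign_coupling {l : ℝ} (hl : 0 < l) {g w g' w' : ℝ → ℝ}
    (hg : ContinuousOn g (Icc 0 l)) (hg' : ∀ x ∈ Ioo 0 l, HasDerivAt g (g' x) x)
    (hw' : ∀ x ∈ Ioc 0 l, HasDerivAt w (w' x) x)
    (hpos : ∀ x ∈ Ioo 0 l, 0 < w x → 0 < g' x) (hzero : ∀ x ∈ Ioo 0 l, g' x = 0 → w x = 0)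
    (hwl : w l = 0) (hg0 : g 0 = 0) (hgl : g l = 0)
    (hneg : ∀ x ∈ Ioc 0 l, g x ≤ 0 → w' x < 0) : False := by
  obtain ⟨m, hm, hmin⟩ : ∃ m ∈ Ioc 0 l, ∀ x ∈ Icc 0 l, g m ≤ g x := by
    obtain ⟨m, hm, hmin⟩ := isCompact_Icc.exists_isMinOn (nonempty_Icc.2 hl.le) hg
    rcases hm.1.eq_or_lt with h | h
    · refine ⟨l, ⟨hl, le_rfl⟩, fun x hx => ?_⟩
      have := hmin hx
      simp only [mem_ofPred_eq, ← h] at this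
      linarith
    · exact ⟨m, ⟨h, hm.2⟩, fun x hx => hmin hx⟩
  have hgm : g m ≤ 0 := hg0 ▸ hmin 0 ⟨le_rfl, hl.le⟩
  have hwm : w m = 0 := by
    rcases hm.2.eq_or_lt with h | h
    · rw [h, hwl]
    · have hmem : m ∈ Ioo 0 l := ⟨hm.1, h⟩
      refine hzero m hmem (IsLocalMin.hasDerivAt_eq_zero ?_ (hg' m hmem))
      filter_upwards [Icc_mem_nhds hm.1 h] with x hx using hmin x hx
  have hslope := (hasDerivAt_iff_tendsto_slope.1 (hw' m hm)).eventually_lt_const (hneg m hm hgm)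
  have hleft : ∀ᶠ x in nhdsWithin m (Iio m), 0 < w x := by
    have : nhdsWithin m (Iio m) ≤ nhdsWithin m {m}ᶜ :=
      nhdsWithin_mono _ fun x hx => ne_of_lt hx
    filter_upwards [this hslope, self_mem_nhdsWithin] with x hx hxm
    have hxm' : x - m < 0 := sub_neg.2 hxm
    rw [slope_def_field, hwm, sub_zero] at hx
    by_contra hc
    exact absurd hx (not_lt.2 (div_nonneg_of_nonpos (not_lt.1 hc) hxm'.le))
  obtain ⟨y, hy, hsub⟩ := (mem_nhdsLT_iff_exists_Ioo_subset' hm.1).1 hleft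
  set z := max y 0 with hz
  have hzm : z < m := max_lt hy hm.1
  have hz0 : 0 ≤ z := le_max_right _ _
  obtain ⟨t, ht, ht'⟩ := exists_hasDerivAt_eq_slope g g' hzm
    (hg.mono (Icc_subset_Icc hz0 hm.2))
    fun x hx => hg' x ⟨hz0.trans_lt hx.1, hx.2.trans_le hm.2⟩
  have hgt : 0 < g' t := hpos t ⟨hz0.trans_lt ht.1, ht.2.trans_le hm.2⟩
    (hsub ⟨(le_max_left _ _).trans_lt ht.1, ht.2⟩)
  rw [ht', lt_div_iff₀ (sub_pos.2 hzm), zero_mul] at hgt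
  linarith [hmin z ⟨hz0, hzm.le.trans hm.2⟩]

/-- If `g` vanishes at both ends and `g' w`, `g w'` are nonnegative, then both vanish. -/
lemma mul_eq_zero_of_nonneg_products {p q : ℝ} (hpq : p < q) {g w g' w' : ℝ → ℝ}
    (hg : ContinuousOn g (Icc p q)) (hw : ContinuousOn w (Icc p q))
    (hg' : ∀ x ∈ Ioo p q, HasDerivAt g (g' x) x) (hw' : ∀ x ∈ Ioo p q, HasDerivAt w (w' x) x)
    (hgp : g p = 0) (hgq : g q = 0)
    (h₁ : ∀ x ∈ Ioo p q, 0 ≤ g' x * w x) (h₂ : ∀ x ∈ Ioo p q, 0 ≤ g x * w' x) :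
    ∀ x ∈ Ioo p q, g' x * w x = 0 ∧ g x * w' x = 0 := by
  have hF : ContinuousOn (fun x => g x * w x) (Icc p q) := hg.mul hw
  have hF' : ∀ x ∈ Ioo p q, HasDerivAt (fun x => g x * w x) (g' x * w x + g x * w' x) x :=
    fun x hx => (hg' x hx).mul (hw' x hx)
  have hmono : MonotoneOn (fun x => g x * w x) (Icc p q) := by
    refine monotoneOn_of_deriv_nonneg (convex_Icc p q) hF ?_ ?_ <;> rw [interior_Icc]
    · exact fun x hx => (hF' x hx).differentiableAt.differentiableWithinAt
    · intro x hx
      rw [(hF' x hx).deriv]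
      exact add_nonneg (h₁ x hx) (h₂ x hx)
  have hzero : ∀ x ∈ Icc p q, g x * w x = 0 := by
    intro x hx
    have hl := hmono (left_mem_Icc.2 hpq.le) hx hx.1
    have hr := hmono hx (right_mem_Icc.2 hpq.le) hx.2
    simp only [hgp, hgq, zero_mul] at hl hr
    exact le_antisymm hr hl
  intro x hx
  have hd : HasDerivAt (fun x => g x * w x) 0 x := by
    refine (hasDerivAt_const x (0 : ℝ)).congr_of_eventuallyEq ?_
    filter_upwards [Icc_mem_nhds hx.1 hx.2] with y hy using hzero y hy
  have := (hF' x hx).unique hd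
  constructor <;> linarith [h₁ x hx, h₂ x hx]

theorem uniqueness_with_reference (L₁ δ L a b ν dm dp km kp qm qp : ℝ) (f r c bm bp : ℝ → ℝ) (u₁ v₁ u₂ v₂ : ℝ → ℝ)
    (hL₁ : 0 < L₁) (hδ : 0 < δ) (hL : L₁ + δ < L)
    (ha : 0 < a) (hb : 0 < b) (hf : Continuous f)
    (hr : ContDiffOn ℝ 1 r (Icc 0 L)) (hrpos : ∀ x ∈ Icc 0 L, 0 < r x)
    (hc : ContDiffOn ℝ 1 c (Icc 0 L)) (hcpos : ∀ x ∈ Icc 0 L, 0 < c x)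
    (hc0 : deriv c 0 = 0) (hcL : deriv c L = 0)
    (hrlc : DifferentiableOn ℝ (fun y => r y * deriv c y / c y) (Ioo 0 L))
    (hbm : ContinuousOn bm (Icc 0 L₁)) (hbmpos : ∀ x ∈ Icc 0 L₁, 0 < bm x)
    (hbp : ContinuousOn bp (Icc (L₁ + δ) L)) (hbppos : ∀ x ∈ Icc (L₁ + δ) L, 0 < bp x)
    (hkm : 0 < km) (hkp : 0 < kp) (hqm : 0 < qm) (hqp : 0 < qp)
    (hsol₁ : IsSolution L₁ δ L a b ν dm dp km kp qm qp f r c bm bp u₁ v₁)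
    (hsol₂ : IsSolution L₁ δ L a b ν dm dp km kp qm qp f r c bm bp u₂ v₂)
    (hv₁ : v₁ 0 = 0) (hv₂ : v₂ 0 = 0) :
    (∀ x ∈ Icc (0:ℝ) L, u₁ x = u₂ x) ∧
      (∀ x ∈ Icc (0:ℝ) L₁ ∪ Icc (L₁ + δ) L, v₁ x = v₂ x) := by
  obtain ⟨hu₁, hru₁, hvd₁, hfm₁, hfs₁, hfp₁, -, -, hgm₁, hgp₁, hv0₁, hvL₁, hvl₁, hvr₁⟩ := hsol₁
  obtain ⟨hu₂, hru₂, hvd₂, hfm₂, hfs₂, hfp₂, -, -, hgm₂, hgp₂, hv0₂, hvL₂, hvl₂, hvr₂⟩ := hsol₂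
  set D : ℝ → ℝ := fun x => E a b f x (v₁ x - u₁ x) - E a b f x (v₂ x - u₂ x) with hD
  set U : ℝ → ℝ := fun x => u₁ x - u₂ x with hU
  set V : ℝ → ℝ := fun x => v₁ x - v₂ x with hV
  set w : ℝ → ℝ := fun x => V x - U x with hw
  set g : ℝ → ℝ := fun x => deriv v₁ x - deriv v₂ x with hg
  set R : ℝ → ℝ := fun x => r x * deriv u₁ x - r x * deriv u₂ x with hR
  have hDpos : ∀ x, 0 < D x ↔ 0 < w x := fun x => by
    rw [hD, sub_pos, (E_strictMono ha hb f x).lt_iff_lt, hw, hV, hU]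
    constructor <;> intro h <;> simp only at * <;> linarith
  have hDneg : ∀ x, D x < 0 ↔ w x < 0 := fun x => by
    rw [hD, sub_neg, (E_strictMono ha hb f x).lt_iff_lt, hw, hV, hU]
    constructor <;> intro h <;> simp only at * <;> linarith
  have hDzero : ∀ x, D x = 0 → w x = 0 := fun x h =>
    le_antisymm (not_lt.1 fun h' => ((hDpos x).2 h').ne' h)
      (not_lt.1 fun h' => ((hDneg x).2 h').ne h)
  have hDw : ∀ x, 0 ≤ D x * w x := fun x => by
    rcases lt_trichotomy (w x) 0 with h | h | h
    · exact (mul_pos_of_neg_of_neg ((hDneg x).2 h) h).le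
    · rw [h, mul_zero]
    · exact (mul_pos ((hDpos x).2 h) h).le
  have hUc : ContinuousOn U (Icc 0 L) := hu₁.continuousOn.sub hu₂.continuousOn
  have hud : ∀ u : ℝ → ℝ, ContDiffOn ℝ 1 u (Icc 0 L) → ∀ x ∈ Ioo 0 L,
      HasDerivAt u (deriv u x) x := fun u hu x hx =>
    (((hu.differentiableOn one_ne_zero) x (Ioo_subset_Icc_self hx)).differentiableAt
      (Icc_mem_nhds hx.1 hx.2)).hasDerivAt
  have hUd : ∀ x ∈ Ioo 0 L, HasDerivAt U (R x / r x) x := fun x hx => by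
    refine ((hud u₁ hu₁ x hx).sub (hud u₂ hu₂ x hx)).congr_deriv ?_
    have := (hrpos x (Ioo_subset_Icc_self hx)).ne'
    simp only [hR]
    field_simp
  have hVd : ∀ x ∈ Icc 0 L₁ ∪ Icc (L₁ + δ) L, HasDerivAt V (g x) x := fun x hx =>
    (hvd₁ x hx).1.hasDerivAt.sub (hvd₂ x hx).1.hasDerivAt
  have hgc : ∀ x ∈ Icc 0 L₁ ∪ Icc (L₁ + δ) L, ContinuousAt g x := fun x hx =>
    (hvd₁ x hx).2.continuousAt.sub (hvd₂ x hx).2.continuousAt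
  have hgdm : ∀ x ∈ Ioo 0 L₁, HasDerivAt g (qm * bm x * D x) x := fun x hx => by
    have hx' := Or.inl (b := x ∈ Icc (L₁ + δ) L) (Ioo_subset_Icc_self hx)
    refine ((hvd₁ x hx').2.hasDerivAt.sub (hvd₂ x hx').2.hasDerivAt).congr_deriv ?_
    rw [hgm₁ x hx, hgm₂ x hx, hD]
    ring
  have hgdp : ∀ x ∈ Ioo (L₁ + δ) L, HasDerivAt g (qp * bp x * D x) x := fun x hx => by
    have hx' := Or.inr (a := x ∈ Icc 0 L₁) (Ioo_subset_Icc_self hx)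
    refine ((hvd₁ x hx').2.hasDerivAt.sub (hvd₂ x hx').2.hasDerivAt).congr_deriv ?_
    rw [hgp₁ x hx, hgp₂ x hx, hD]
    ring
  have hg0 : g 0 = 0 := by simp only [hg, hv0₁, hv0₂, sub_self]
  have hgL₁ : g L₁ = 0 := by simp only [hg, hvl₁, hvl₂, sub_self]
  have hgL₂ : g (L₁ + δ) = 0 := by simp only [hg, hvr₁, hvr₂, sub_self]
  have hgL : g L = 0 := by simp only [hg, hvL₁, hvL₂, sub_self]
  have hRd : ∀ x ∈ Ioo 0 L,
      HasDerivAt R (-(deriv (flux r c ν u₁) x - deriv (flux r c ν u₂) x)) x := fun x hx => by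
    have hnhds := isOpen_Ioo.mem_nhds hx
    have d₁ := (hru₁ x hx).differentiableAt hnhds
    have d₂ := (hru₂ x hx).differentiableAt hnhds
    have d₃ := (hrlc x hx).differentiableAt hnhds
    have e₁ : DifferentiableAt ℝ (flux r c ν u₁) x := d₁.neg.add (d₃.const_mul ν)
    have e₂ : DifferentiableAt ℝ (flux r c ν u₂) x := d₂.neg.add (d₃.const_mul ν)
    refine (e₁.hasDerivAt.sub e₂.hasDerivAt).neg.congr_of_eventuallyEq
      (Filter.Eventually.of_forall fun y => ?_)
    simp only [hR, flux, Pi.neg_apply, Pi.sub_apply]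
    ring
  have hRc : ContinuousOn R (Ioo 0 L) := fun x hx => (hRd x hx).continuousAt.continuousWithinAt
  have hRdm : ∀ x ∈ Ioo 0 L₁, HasDerivAt R (-(km * bm x * D x)) x := fun x hx => by
    refine (hRd x ⟨hx.1, by linarith [hx.2]⟩).congr_deriv ?_
    rw [hfm₁ x hx, hfm₂ x hx, hD]
    ring
  have hRds : ∀ x ∈ Ioo L₁ (L₁ + δ), HasDerivAt R 0 x := fun x hx => by
    refine (hRd x ⟨by linarith [hx.1], by linarith [hx.2]⟩).congr_deriv ?_
    rw [hfs₁ x hx, hfs₂ x hx]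
    ring
  have hRdp : ∀ x ∈ Ioo (L₁ + δ) L, HasDerivAt R (-(kp * bp x * D x)) x := fun x hx => by
    refine (hRd x ⟨by linarith [hx.1], hx.2⟩).congr_deriv ?_
    rw [hfp₁ x hx, hfp₂ x hx, hD]
    ring
  have hL₁mem : L₁ ∈ Ioo 0 L := ⟨hL₁, by linarith⟩
  -- differentiability of `r u'` across the interface forces `w L₁ = 0`
  have hwL₁ : w L₁ = 0 := by
    refine hDzero _ ?_
    have hRL := hRd L₁ hL₁mem
    have hright : HasDerivWithinAt R 0 (Ici L₁) L₁ := by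
      refine hasDerivWithinAt_Ici_of_tendsto_deriv (s := Ioo L₁ (L₁ + δ))
        (fun x hx => (hRds x hx).differentiableAt.differentiableWithinAt)
        hRL.continuousAt.continuousWithinAt (Ioo_mem_nhdsGT (by linarith)) ?_
      refine tendsto_const_nhds.congr' ?_
      filter_upwards [Ioo_mem_nhdsGT (show L₁ < L₁ + δ by linarith)] with x hx
      rw [(hRds x hx).deriv]
    have hleft : HasDerivWithinAt R (-(km * bm L₁ * D L₁)) (Iic L₁) L₁ := by
      refine hasDerivWithinAt_Iic_of_tendsto_deriv (s := Ioo 0 L₁)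
        (fun x hx => (hRdm x hx).differentiableAt.differentiableWithinAt)
        hRL.continuousAt.continuousWithinAt (Ioo_mem_nhdsLT hL₁) ?_
      have hDc : ContinuousAt D L₁ := by
        have m : L₁ ∈ Icc 0 L₁ ∪ Icc (L₁ + δ) L := Or.inl ⟨hL₁.le, le_rfl⟩
        have c₁ := (hvd₁ L₁ m).1.continuousAt
        have c₂ := (hvd₂ L₁ m).1.continuousAt
        have c₃ := (hud u₁ hu₁ L₁ hL₁mem).continuousAt
        have c₄ := (hud u₂ hu₂ L₁ hL₁mem).continuousAt
        have c₅ := hf.continuousAt (x := L₁)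
        simp only [hD, E]
        fun_prop
      have hbc : Filter.Tendsto bm (nhdsWithin L₁ (Iio L₁)) (nhds (bm L₁)) :=
        (hbm L₁ ⟨hL₁.le, le_rfl⟩).tendsto.mono_left <| by
          rw [← nhdsWithin_Ioo_eq_nhdsLT hL₁]
          exact nhdsWithin_mono _ Ioo_subset_Icc_self
      refine ((hbc.const_mul km).mul (hDc.tendsto.mono_left nhdsWithin_le_nhds)).neg.congr' ?_
      filter_upwards [Ioo_mem_nhdsLT hL₁] with x hx
      rw [(hRdm x hx).deriv]
    have h₁ := (uniqueDiffWithinAt_Ici L₁).eq_deriv _ hright hRL.hasDerivWithinAt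
    have h₂ := (uniqueDiffWithinAt_Iic L₁).eq_deriv _ hleft hRL.hasDerivWithinAt
    have h₃ := mul_pos hkm (hbmpos L₁ ⟨hL₁.le, le_rfl⟩)
    have h₄ : km * bm L₁ * D L₁ = 0 := by linarith
    exact (mul_eq_zero.1 h₄).resolve_left h₃.ne'
  have hRm : ∀ x ∈ Ioc 0 L₁, R x = R L₁ - km / qm * g x := fun x hx => by
    have := eq_of_hasDerivAt_zero (F := fun y => R y + km / qm * g y) hx.2
      (fun y hy => ((hRd y ⟨by linarith [hx.1, hy.1], by linarith [hy.2]⟩).continuousAt.add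
        ((hgc y (Or.inl ⟨by linarith [hx.1, hy.1], hy.2⟩)).const_mul _)).continuousWithinAt)
      (fun y hy => by
        have hy' : y ∈ Ioo 0 L₁ := ⟨hx.1.trans hy.1, hy.2⟩
        refine ((hRdm y hy').add ((hgdm y hy').const_mul _)).congr_deriv ?_
        field_simp
        ring)
    simp only [hgL₁] at this
    linarith
  have hκm : 0 < km / qm := div_pos hkm hqm
  have hκp : 0 < kp / qp := div_pos hkp hqp
  have hwdm : ∀ x ∈ Ioc 0 L₁, HasDerivAt w (g x - R x / r x) x := fun x hx =>
    (hVd x (Or.inl ⟨hx.1.le, hx.2⟩)).sub (hUd x ⟨hx.1, by linarith [hx.2]⟩)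
  have hgcm : ContinuousOn g (Icc 0 L₁) := fun x hx => (hgc x (Or.inl hx)).continuousWithinAt
  have hgcp : ContinuousOn g (Icc (L₁ + δ) L) := fun x hx => (hgc x (Or.inr hx)).continuousWithinAt
  have hqbm : ∀ x ∈ Ioo 0 L₁, 0 < qm * bm x := fun x hx =>
    mul_pos hqm (hbmpos x (Ioo_subset_Icc_self hx))
  have hqbp : ∀ x ∈ Ioo (L₁ + δ) L, 0 < qp * bp x := fun x hx =>
    mul_pos hqp (hbppos x (Ioo_subset_Icc_self hx))
  have hrm : ∀ x ∈ Ioc 0 L₁, 0 < r x := fun x hx => hrpos x ⟨hx.1.le, by linarith [hx.2]⟩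
  have hRL₁ : R L₁ = 0 := by
    rcases lt_trichotomy (R L₁) 0 with h | h | h
    · refine (false_of_sign_coupling (g := fun x => -g x) (w := fun x => -w x) hL₁ hgcm.neg
        (fun x hx => (hgdm x hx).neg) (fun x hx => (hwdm x hx).neg) (fun x hx h' => ?_)
        (fun x hx h' => ?_) (by simp only [hwL₁, neg_zero]) (by simp only [hg0, neg_zero])
        (by simp only [hgL₁, neg_zero]) fun x hx h' => ?_).elim
      · exact neg_pos.2 (mul_neg_of_pos_of_neg (hqbm x hx) ((hDneg x).2 (neg_pos.1 h')))
      · rw [hDzero x ((mul_eq_zero.1 (neg_eq_zero.1 h')).resolve_left (hqbm x hx).ne'), neg_zero]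
      · have hgx : 0 ≤ g x := by linarith
        have : R x / r x < 0 := div_neg_of_neg_of_pos
          (by rw [hRm x hx]; linarith [mul_nonneg hκm.le hgx]) (hrm x hx)
        linarith
    · exact h
    · refine (false_of_sign_coupling hL₁ hgcm hgdm hwdm (fun x hx h' => ?_)
        (fun x hx h' => ?_) hwL₁ hg0 hgL₁ fun x hx h' => ?_).elim
      · exact mul_pos (hqbm x hx) ((hDpos x).2 h')
      · exact hDzero x ((mul_eq_zero.1 h').resolve_left (hqbm x hx).ne')
      · have : 0 < R x / r x := div_pos
          (by rw [hRm x hx]; linarith [mul_nonneg hκm.le (neg_nonneg.2 h')]) (hrm x hx)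
        linarith
  have hVc : ∀ x ∈ Icc 0 L₁ ∪ Icc (L₁ + δ) L, ContinuousAt V x := fun x hx =>
    (hVd x hx).continuousAt
  have hVcm : ContinuousOn V (Icc 0 L₁) := fun x hx => (hVc x (Or.inl hx)).continuousWithinAt
  have hVcp : ContinuousOn V (Icc (L₁ + δ) L) := fun x hx => (hVc x (Or.inr hx)).continuousWithinAt
  have hUcm : ContinuousOn U (Icc 0 L₁) := hUc.mono (Icc_subset_Icc le_rfl (by linarith))
  have hUcs : ContinuousOn U (Icc L₁ (L₁ + δ)) := hUc.mono (Icc_subset_Icc hL₁.le hL.le)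
  have hUcp : ContinuousOn U (Icc (L₁ + δ) L) := hUc.mono (Icc_subset_Icc (by linarith) le_rfl)
  have energy : ∀ {s κ ρ : ℝ}, 0 < κ → 0 < ρ → s * (s - -(κ * s) / ρ) = s ^ 2 * (1 + κ / ρ) := by
    intro s κ ρ hκ hρ
    field_simp
    ring
  -- negative electrode
  have hm : ∀ x ∈ Ioo 0 L₁, w x = 0 ∧ g x = 0 := fun x hx => by
    have hRx : ∀ y ∈ Ioo 0 L₁, g y * (g y - R y / r y) = g y ^ 2 * (1 + km / qm / r y) :=
      fun y hy => by
        rw [hRm y (Ioo_subset_Ioc_self hy), hRL₁, zero_sub,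
          energy hκm (hrm y (Ioo_subset_Ioc_self hy))]
    have hpos : ∀ y ∈ Ioo 0 L₁, 0 < 1 + km / qm / r y := fun y hy => by
      linarith [div_pos hκm (hrm y (Ioo_subset_Ioc_self hy))]
    obtain ⟨h₁, h₂⟩ := mul_eq_zero_of_nonneg_products hL₁ hgcm (hVcm.sub hUcm) hgdm
      (fun y hy => hwdm y (Ioo_subset_Ioc_self hy)) hg0 hgL₁
      (fun y hy => by rw [mul_assoc]; exact mul_nonneg (hqbm y hy).le (hDw y))
      (fun y hy => by rw [hRx y hy]; exact mul_nonneg (sq_nonneg _) (hpos y hy).le) x hx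
    rw [hRx x hx] at h₂
    refine ⟨?_, pow_eq_zero_iff two_ne_zero |>.1 ((mul_eq_zero.1 h₂).resolve_right (hpos x hx).ne')⟩
    rcases mul_eq_zero.1 h₁ with h | h
    · exact hDzero x ((mul_eq_zero.1 h).resolve_left (hqbm x hx).ne')
    · exact h
  have hVm : ∀ x ∈ Icc 0 L₁, V x = 0 := fun x hx => by
    rw [eq_of_hasDerivAt_zero hx.1 (hVcm.mono (Icc_subset_Icc le_rfl hx.2)) fun y hy => ?_]
    · simp only [hV, hv₁, hv₂, sub_self]
    · have hy' : y ∈ Ioo 0 L₁ := ⟨hy.1, hy.2.trans_le hx.2⟩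
      rw [← (hm y hy').2]
      exact hVd y (Or.inl (Ioo_subset_Icc_self hy'))
  have hUm : ∀ x ∈ Icc 0 L₁, U x = 0 := eq_zero_on_Icc_of_Ioo hL₁ hUcm fun x hx => by
    have h₁ : V x - U x = 0 := (hm x hx).1
    linarith [hVm x (Ioo_subset_Icc_self hx)]
  -- separator
  have hRs : ∀ x ∈ Icc L₁ (L₁ + δ), R x = 0 := fun x hx => by
    rw [eq_of_hasDerivAt_zero hx.1 (hRc.mono fun y hy => ⟨by linarith [hy.1],
      by linarith [hy.2, hx.2]⟩) fun y hy => hRds y ⟨hy.1, hy.2.trans_le hx.2⟩, hRL₁]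
  have hUs : ∀ x ∈ Icc L₁ (L₁ + δ), U x = 0 := fun x hx => by
    rw [eq_of_hasDerivAt_zero hx.1 (hUcs.mono (Icc_subset_Icc le_rfl hx.2)) fun y hy => ?_,
      hUm L₁ ⟨hL₁.le, le_rfl⟩]
    have := hUd y ⟨by linarith [hy.1], by linarith [hy.2, hx.2]⟩
    rwa [hRs y ⟨hy.1.le, hy.2.le.trans hx.2⟩, zero_div] at this
  -- positive electrode
  have hRp : ∀ x ∈ Ico (L₁ + δ) L, R x = -(kp / qp * g x) := fun x hx => by
    have := eq_of_hasDerivAt_zero (F := fun y => R y + kp / qp * g y) hx.1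
      (fun y hy => ((hRd y ⟨by linarith [hy.1], by linarith [hy.2, hx.2]⟩).continuousAt.add
        ((hgc y (Or.inr ⟨hy.1, by linarith [hy.2, hx.2]⟩)).const_mul _)).continuousWithinAt)
      (fun y hy => by
        have hy' : y ∈ Ioo (L₁ + δ) L := ⟨hy.1, hy.2.trans hx.2⟩
        refine ((hRdp y hy').add ((hgdp y hy').const_mul _)).congr_deriv ?_
        field_simp
        ring)
    simp only [hgL₂, hRs (L₁ + δ) ⟨by linarith, le_rfl⟩] at this
    linarith
  have hp : ∀ x ∈ Ioo (L₁ + δ) L, w x = 0 ∧ g x = 0 := fun x hx => by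
    have hrp : ∀ y ∈ Ioo (L₁ + δ) L, 0 < r y := fun y hy =>
      hrpos y ⟨by linarith [hy.1], hy.2.le⟩
    have hRx : ∀ y ∈ Ioo (L₁ + δ) L, g y * (g y - R y / r y) = g y ^ 2 * (1 + kp / qp / r y) :=
      fun y hy => by rw [hRp y (Ioo_subset_Ico_self hy), energy hκp (hrp y hy)]
    have hpos : ∀ y ∈ Ioo (L₁ + δ) L, 0 < 1 + kp / qp / r y := fun y hy => by
      linarith [div_pos hκp (hrp y hy)]
    obtain ⟨h₁, h₂⟩ := mul_eq_zero_of_nonneg_products hL hgcp (hVcp.sub hUcp) hgdp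
      (fun y hy => (hVd y (Or.inr (Ioo_subset_Icc_self hy))).sub
        (hUd y ⟨by linarith [hy.1], hy.2⟩)) hgL₂ hgL
      (fun y hy => by rw [mul_assoc]; exact mul_nonneg (hqbp y hy).le (hDw y))
      (fun y hy => by rw [hRx y hy]; exact mul_nonneg (sq_nonneg _) (hpos y hy).le) x hx
    rw [hRx x hx] at h₂
    refine ⟨?_, pow_eq_zero_iff two_ne_zero |>.1 ((mul_eq_zero.1 h₂).resolve_right (hpos x hx).ne')⟩
    rcases mul_eq_zero.1 h₁ with h | h
    · exact hDzero x ((mul_eq_zero.1 h).resolve_left (hqbp x hx).ne')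
    · exact h
  have hUp : ∀ x ∈ Icc (L₁ + δ) L, U x = 0 := fun x hx => by
    rw [eq_of_hasDerivAt_zero hx.1 (hUcp.mono (Icc_subset_Icc le_rfl hx.2)) fun y hy => ?_,
      hUs (L₁ + δ) ⟨by linarith, le_rfl⟩]
    have hy' : y ∈ Ioo (L₁ + δ) L := ⟨hy.1, hy.2.trans_le hx.2⟩
    have := hUd y ⟨by linarith [hy.1], hy'.2⟩
    rwa [hRp y (Ioo_subset_Ico_self hy'), (hp y hy').2, mul_zero, neg_zero, zero_div] at this
  have hVp : ∀ x ∈ Icc (L₁ + δ) L, V x = 0 := eq_zero_on_Icc_of_Ioo hL hVcp fun x hx => by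
    have h₁ : V x - U x = 0 := (hp x hx).1
    linarith [hUp x (Ioo_subset_Icc_self hx)]
  constructor
  · intro x hx
    refine sub_eq_zero.1 (show U x = 0 from ?_)
    rcases le_total x L₁ with h | h
    · exact hUm x ⟨hx.1, h⟩
    rcases le_total x (L₁ + δ) with h' | h'
    · exact hUs x ⟨h, h'⟩
    · exact hUp x ⟨h', hx.2⟩
  · rintro x (hx | hx)
    · exact sub_eq_zero.1 (hVm x hx)
    · exact sub_eq_zero.1 (hVp x hx)
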